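/- arXiv:1306.3191 — 2 statements merged into one kernel-verified Lean document; each statement's English description precedes it below -/
import Mathlib

section
/- Suppose the primal problem (P) has an optimal solution, that 0 ∈ sqri(dom (g_i ∘ K_i)* − dom (l_i ∘ M_i)*) for every i = 1,…,m, and that 0 ∈ sqri E, where E = { ( (K_i(L_i(dom f) − r_i − y_i) − dom g_i)_{i=1}^m, (M_i y_i − dom l_i)_{i=1}^m ) : y_i ∈ G_i, i = 1,…,m } ⊆ X ⊕ Y. Then z ∈ ran( ∂f + Σ_{i=1}^m L_i*((K_i* ∘ ∂g_i ∘ K_i) □ (M_i* ∘ ∂l_i ∘ M_i))(L_i · − r_i) + ∇h ). -/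
open scoped RealInnerProductSpace ENNReal
open Filter Topology

noncomputable section

/-- `f ∈ Γ(E)`: proper, convex and lower semicontinuous -/
def ProperConvLsc {E : Type*} [NormedAddCommGroup E] [InnerProductSpace ℝ E]
    (f : E → EReal) : Prop :=
  (∃ x, f x ≠ ⊤) ∧ (∀ x, f x ≠ ⊥) ∧
  (∀ x y : E, ∀ a b : ℝ, 0 ≤ a → 0 ≤ b → a + b = 1 →
    f (a • x + b • y) ≤ (a : EReal) * f x + (b : EReal) * f y) ∧
  LowerSemicontinuous f

/-- Fenchel conjugate -/
def econj {E : Type*} [NormedAddCommGroup E] [InnerProductSpace ℝ E]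
    (f : E → EReal) (p : E) : EReal :=
  ⨆ x : E, ((⟪p, x⟫ : ℝ) : EReal) - f x

/-- infimal convolution -/
def einfConv {E : Type*} [AddGroup E] (f g : E → EReal) (x : E) : EReal :=
  ⨅ y : E, f y + g (x - y)

/-- convex subdifferential -/
def esubdiff {E : Type*} [NormedAddCommGroup E] [InnerProductSpace ℝ E]
    (f : E → EReal) (x : E) : Set E :=
  {p | f x ≠ ⊤ ∧ f x ≠ ⊥ ∧ ∀ y, f x + ((⟪p, y - x⟫ : ℝ) : EReal) ≤ f y}

/-- effective domain -/
def edom {E : Type*} (f : E → EReal) : Set E := {x | f x ≠ ⊤}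

def invOp {E : Type*} (A : E → Set E) : E → Set E := fun u => {x | u ∈ A x}

def sumOp {E : Type*} [Add E] (A B : E → Set E) : E → Set E :=
  fun x => {s | ∃ u ∈ A x, ∃ v ∈ B x, s = u + v}

/-- parallel sum `A □ B = (A⁻¹ + B⁻¹)⁻¹` -/
def parOp {E : Type*} [Add E] (A B : E → Set E) : E → Set E :=
  invOp (sumOp (invOp A) (invOp B))

/-- `T* ∘ B ∘ T` -/
def compOp {F G : Type*} [NormedAddCommGroup F] [InnerProductSpace ℝ F] [CompleteSpace F]
    [NormedAddCommGroup G] [InnerProductSpace ℝ G] [CompleteSpace G]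
    (T : F →L[ℝ] G) (B : G → Set G) : F → Set F :=
  fun x => (ContinuousLinearMap.adjoint T) '' (B (T x))

open Pointwise in
/-- `x` belongs to the strong quasi-relative interior of `Ω` -/
def sqriMem {E : Type*} [AddCommGroup E] [Module ℝ E] [TopologicalSpace E]
    (Ω : Set E) (x : E) : Prop :=
  x ∈ Ω ∧ ∃ S : Submodule ℝ E, IsClosed (S : Set E) ∧
    (⋃ lam ∈ Set.Ici (0:ℝ), lam • ((fun w => w - x) '' Ω)) = (S : Set E)

/-- If the `W`-section of a convex set is absorbing, so is the section over the unit ball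
around a base point. -/
theorem exists_pos_smul_mem_section {Z W : Type*} [NormedAddCommGroup Z] [NormedSpace ℝ Z]
    [NormedAddCommGroup W] [NormedSpace ℝ W] {C : Set (Z × W)} (hC : Convex ℝ C)
    {z₀ : Z} (h₀ : (z₀, (0 : W)) ∈ C)
    {w : W} (habs : ∃ t : ℝ, 0 < t ∧ ∃ z, (z, t • w) ∈ C) :
    ∃ t : ℝ, 0 < t ∧ ∃ z, ‖z - z₀‖ ≤ 1 ∧ (z, t • w) ∈ C := by
  obtain ⟨t, ht, z, hz⟩ := habs
  have hpos : 0 < 1 + ‖z - z₀‖ := by positivity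
  set ε : ℝ := (1 + ‖z - z₀‖)⁻¹ with hε
  have hε0 : 0 < ε := by positivity
  have hε1 : ε ≤ 1 := inv_le_one_of_one_le₀ (by linarith [norm_nonneg (z - z₀)])
  refine ⟨ε * t, by positivity, z₀ + ε • (z - z₀), ?_, ?_⟩
  · rw [add_sub_cancel_left, norm_smul, Real.norm_of_nonneg hε0.le, hε,
      inv_mul_le_iff₀ hpos]
    linarith
  · have := hC h₀ hz (a := 1 - ε) (b := ε) (by linarith) hε0.le (by ring)
    convert this using 1
    ext
    · simp only [Prod.smul_mk, Prod.mk_add_mk]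
      module
    · simp [mul_smul]

/-- The iterated-midpoint form of a dyadic convex combination. -/
theorem Convex.dyadic_sum_mem {E : Type*} [AddCommGroup E] [Module ℝ E] {C : Set E}
    (hC : Convex ℝ C) {x : ℕ → E} (hx : ∀ n, x n ∈ C) (n : ℕ) :
    ∀ c ∈ C, ∑ k ∈ Finset.range n, ((1 / 2 : ℝ) ^ (k + 1)) • x k + ((1 / 2 : ℝ) ^ n) • c ∈ C := by
  induction n with
  | zero => intro c hc; simpa using hc
  | succ n ih =>
    intro c hc
    have := ih _ (hC (hx n) hc (a := 1 / 2) (b := 1 / 2) (by norm_num) (by norm_num) (by norm_num))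
    convert this using 1
    rw [Finset.sum_range_succ, pow_succ]
    module

/-- A form of the Robinson–Ursescu theorem: if the projection onto `W` of a closed convex set is
absorbing, then the points over a unit ball already project onto a neighbourhood of `0`. -/
theorem exists_ball_subset_section {Z W : Type*} [NormedAddCommGroup Z] [NormedSpace ℝ Z]
    [CompleteSpace Z] [NormedAddCommGroup W] [NormedSpace ℝ W] [CompleteSpace W]
    {C : Set (Z × W)} (hC : Convex ℝ C) (hcl : IsClosed C)
    {z₀ : Z} (h₀ : (z₀, (0 : W)) ∈ C)
    (habs : ∀ w : W, ∃ t : ℝ, 0 < t ∧ ∃ z, (z, t • w) ∈ C) :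
    ∃ δ : ℝ, 0 < δ ∧ ∀ w : W, ‖w‖ < δ → ∃ z, ‖z - z₀‖ ≤ 1 ∧ (z, w) ∈ C := by
  set B : Set W := {w | ∃ z, ‖z - z₀‖ ≤ 1 ∧ (z, w) ∈ C} with hB
  have hBconv : Convex ℝ B := by
    rintro w ⟨z, hz, hzC⟩ w' ⟨z', hz', hzC'⟩ a b ha hb hab
    refine ⟨a • z + b • z', ?_, hC hzC hzC' ha hb hab⟩
    have := convex_closedBall z₀ (1 : ℝ) (x := z) (by simpa [dist_eq_norm] using hz)
      (y := z') (by simpa [dist_eq_norm] using hz') ha hb hab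
    simpa [dist_eq_norm] using this
  have hB0 : (0 : W) ∈ B := ⟨z₀, by simp, h₀⟩
  have hBabs : ∀ w : W, ∃ t : ℝ, 0 < t ∧ t • w ∈ B := fun w ↦
    exists_pos_smul_mem_section hC h₀ (habs w)
  have hcov : ⋃ n : ℕ, (fun w : W ↦ ((n : ℝ) + 1)⁻¹ • w) ⁻¹' closure B = Set.univ := by
    refine Set.eq_univ_of_forall fun w ↦ ?_
    obtain ⟨t, ht, htw⟩ := hBabs w
    obtain ⟨n, hn⟩ := exists_nat_one_div_lt ht
    refine Set.mem_iUnion.2 ⟨n, subset_closure ?_⟩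
    have hn' : ((n : ℝ) + 1)⁻¹ / t ≤ 1 := by
      rw [div_le_one ht, ← one_div]; exact hn.le
    have := hBconv.smul_mem_of_zero_mem hB0 htw (t := ((n : ℝ) + 1)⁻¹ / t)
      ⟨by positivity, hn'⟩
    rwa [smul_smul, div_mul_cancel₀ _ ht.ne'] at this
  obtain ⟨n, hn⟩ := nonempty_interior_of_iUnion_of_closed
    (fun n : ℕ ↦ isClosed_closure.preimage (continuous_const_smul (((n : ℝ) + 1)⁻¹))) hcov
  obtain ⟨w₁, hw₁⟩ : (interior (closure B)).Nonempty := by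
    obtain ⟨w, hw⟩ := hn
    refine ⟨((n : ℝ) + 1)⁻¹ • w, ?_⟩
    have hne : ((n : ℝ) + 1)⁻¹ ≠ 0 := by positivity
    have hw' : w ∈ interior (Homeomorph.smulOfNeZero _ hne ⁻¹' closure B) := hw
    rwa [← Homeomorph.preimage_interior] at hw'
  have h0int : (0 : W) ∈ interior (closure B) := by
    obtain ⟨t, ht, htw⟩ := hBabs (-w₁)
    have := hBconv.closure.combo_interior_closure_mem_interior hw₁
      (subset_closure (subset_closure htw)) (a := t / (1 + t)) (b := 1 / (1 + t))
      (by positivity) (by positivity) (by field_simp; ring)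
    convert this using 1
    rw [smul_smul, smul_neg, ← sub_eq_add_neg, ← sub_smul]
    field_simp
    simp
  obtain ⟨δ, hδ, hball⟩ := Metric.mem_nhds_iff.1 (mem_interior_iff_mem_nhds.1 h0int)
  refine ⟨δ / 2, by positivity, fun w hw ↦ ?_⟩
  have hstep : ∀ e : {e : W // ‖e‖ < δ / 2},
      ∃ p : Z × W, p ∈ C ∧ ‖p.1 - z₀‖ ≤ 1 ∧ ‖(2 : ℝ) • e.1 - p.2‖ < δ / 2 := by
    rintro ⟨e, he⟩
    have hmem : (2 : ℝ) • e ∈ closure B := by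
      apply hball
      rw [mem_ball_zero_iff, norm_smul, Real.norm_of_nonneg (by norm_num)]
      linarith
    obtain ⟨b, ⟨z, hz, hzC⟩, hb⟩ := Metric.mem_closure_iff.1 hmem (δ / 2) (by positivity)
    exact ⟨(z, b), hzC, hz, by rwa [dist_eq_norm] at hb⟩
  choose p hpC hpz hpe using hstep
  let e : ℕ → {e : W // ‖e‖ < δ / 2} := fun n ↦
    Nat.rec ⟨w, hw⟩ (fun _ e ↦ ⟨(2 : ℝ) • e.1 - (p e).2, hpe e⟩) n
  have he : ∀ n, (e (n + 1)).1 = (2 : ℝ) • (e n).1 - (p (e n)).2 := fun _ ↦ rfl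
  let s : ℕ → Z := fun n ↦
    ∑ k ∈ Finset.range n, ((1 / 2 : ℝ) ^ (k + 1)) • (p (e k)).1 + ((1 / 2 : ℝ) ^ n) • z₀
  have hsum : ∀ n, ∑ k ∈ Finset.range n, ((1 / 2 : ℝ) ^ (k + 1)) • (p (e k)).2
      = w - ((1 / 2 : ℝ) ^ n) • (e n).1 := by
    intro n
    induction n with
    | zero => simp [e]
    | succ n ih =>
      rw [Finset.sum_range_succ, ih, he, pow_succ]
      module
  have hsC : ∀ n, (s n, w - ((1 / 2 : ℝ) ^ n) • (e n).1) ∈ C := by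
    intro n
    have := hC.dyadic_sum_mem (fun k ↦ hpC (e k)) n _ h₀
    convert this using 1
    ext
    · simp [s, Prod.fst_sum]
    · simpa [Prod.snd_sum] using (hsum n).symm
  have hdist : ∀ n, dist (s n) (s (n + 1)) ≤ (1 : ℝ) / 2 / 2 ^ n := by
    intro n
    have : s n - s (n + 1) = -(((1 / 2 : ℝ) ^ (n + 1)) • ((p (e n)).1 - z₀)) := by
      simp only [s, Finset.sum_range_succ]
      rw [pow_succ]
      module
    rw [dist_eq_norm, this, norm_neg, norm_smul, Real.norm_of_nonneg (by positivity)]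
    calc _ ≤ (1 / 2 : ℝ) ^ (n + 1) * 1 := by gcongr; exact hpz _
      _ = _ := by rw [pow_succ, one_div_pow]; ring
  obtain ⟨s', hs'⟩ := cauchySeq_tendsto_of_complete (cauchySeq_of_le_geometric_two hdist)
  refine ⟨s', ?_, ?_⟩
  · have := dist_le_of_le_geometric_two_of_tendsto₀ hdist hs'
    rw [dist_comm, dist_eq_norm] at this
    simpa [s] using this
  · refine hcl.mem_of_tendsto (hs'.prodMk_nhds ?_) (Eventually.of_forall hsC)
    have hz : Tendsto (fun n : ℕ ↦ ((1 / 2 : ℝ) ^ n) • (e n).1) atTop (𝓝 0) := by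
      refine squeeze_zero_norm (a := fun n : ℕ ↦ (1 / 2 : ℝ) ^ n * (δ / 2)) (fun n ↦ ?_) ?_
      · rw [norm_smul, Real.norm_of_nonneg (by positivity)]
        gcongr
        exact (e n).2.le
      · simpa using (tendsto_pow_atTop_nhds_zero_of_lt_one (r := (1 / 2 : ℝ)) (by norm_num)
          (by norm_num)).mul_const (δ / 2)
    simpa using tendsto_const_nhds.sub hz

/-- Existence of a Lagrange multiplier for a linear functional on a closed convex set under an
absorption constraint qualification. -/
theorem exists_multiplier_of_absorbing {Z W : Type*} [NormedAddCommGroup Z] [NormedSpace ℝ Z]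
    [CompleteSpace Z] [NormedAddCommGroup W] [NormedSpace ℝ W] [CompleteSpace W]
    {C : Set (Z × W)} (hC : Convex ℝ C) (hcl : IsClosed C)
    {z₀ : Z} (h₀ : (z₀, (0 : W)) ∈ C)
    (habs : ∀ w : W, ∃ t : ℝ, 0 < t ∧ ∃ z, (z, t • w) ∈ C)
    (φ : Z →L[ℝ] ℝ) {α : ℝ} (hα : ∀ z, (z, (0 : W)) ∈ C → α ≤ φ z) :
    ∃ q : W →L[ℝ] ℝ, ∀ p ∈ C, α ≤ φ p.1 + q p.2 := by
  obtain ⟨δ, hδ, hball⟩ := exists_ball_subset_section hC hcl h₀ habs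
  set U : Set (W × ℝ) := {p | ∃ z, (z, p.1) ∈ C ∧ φ z < p.2} with hU
  have hUconv : Convex ℝ U := by
    rintro p ⟨z, hz, hzφ⟩ p' ⟨z', hz', hzφ'⟩ a b ha hb hab
    refine ⟨a • z + b • z', hC hz hz' ha hb hab, ?_⟩
    have := (convex_Ioi (0 : ℝ)) (x := p.2 - φ z) (by simpa using hzφ)
      (y := p'.2 - φ z') (by simpa using hzφ') ha hb hab
    simp only [smul_eq_mul, Set.mem_Ioi] at this
    simp only [map_add, map_smul, smul_eq_mul, Prod.snd_add, Prod.smul_snd]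
    linarith
  set c : ℝ := φ z₀ + ‖φ‖ with hc
  have hint : Metric.ball (0 : W) δ ×ˢ Set.Ioi c ⊆ interior U := by
    refine interior_maximal ?_ (Metric.isOpen_ball.prod isOpen_Ioi)
    rintro ⟨w, t⟩ ⟨hw, ht⟩
    obtain ⟨z, hz, hzC⟩ := hball w (by simpa using hw)
    refine ⟨z, hzC, ?_⟩
    have h1 : φ z - φ z₀ ≤ ‖φ‖ := by
      rw [← map_sub]
      calc _ ≤ ‖φ (z - z₀)‖ := Real.le_norm_self _
        _ ≤ ‖φ‖ * ‖z - z₀‖ := φ.le_opNorm _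
        _ ≤ ‖φ‖ * 1 := by gcongr
        _ = _ := mul_one _
    have ht' : c < t := ht
    simp only
    linarith
  have hnot : ((0 : W), α) ∉ interior U := fun hmem ↦ by
    obtain ⟨z, hz, hzφ⟩ := interior_subset hmem
    exact absurd (hα z hz) (not_le.2 hzφ)
  obtain ⟨F, hF⟩ := geometric_hahn_banach_open_point hUconv.interior isOpen_interior hnot
  have hsplit : ∀ (w : W) (t : ℝ), F (w, t) = F (w, 0) + t * F (0, 1) := by
    intro w t
    have : ((w, t) : W × ℝ) = (w, 0) + t • (0, 1) := by simp
    rw [this, map_add, map_smul, smul_eq_mul]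
  have hle : ∀ p ∈ U, F p ≤ F (0, α) := by
    intro p hp
    have hne : (interior U).Nonempty := ⟨(0, c + 1), hint ⟨by simpa using hδ, by simp⟩⟩
    have hmem : p ∈ closure (interior U) := by
      rw [hUconv.closure_interior_eq_closure_of_nonempty_interior hne]
      exact subset_closure hp
    have hclosed : IsClosed {p : W × ℝ | F p ≤ F (0, α)} :=
      isClosed_le F.continuous continuous_const
    exact closure_minimal (fun a ha ↦ (hF a ha).le) hclosed hmem
  have hneg : F (0, 1) < 0 := by
    have h1 := hF (0, max c α + 1) (hint ⟨by simpa using hδ, by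
      simp only [Set.mem_Ioi]; linarith [le_max_left c α]⟩)
    rw [hsplit 0 (max c α + 1), hsplit 0 α] at h1
    have h2 : 0 < max c α + 1 - α := by linarith [le_max_right c α]
    by_contra! h3
    nlinarith
  refine ⟨(F (0, 1))⁻¹ • (F.comp (ContinuousLinearMap.inl ℝ W ℝ)), ?_⟩
  rintro ⟨z, w⟩ hzw
  refine le_of_forall_pos_le_add fun ε hε ↦ ?_
  have h1 := hle (w, φ z + ε) ⟨z, hzw, by simpa using hε⟩
  rw [hsplit, hsplit 0 α] at h1
  have h00 : F ((0 : W), (0 : ℝ)) = 0 := map_zero F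
  rw [h00, zero_add] at h1
  simp only [smul_apply, ContinuousLinearMap.comp_apply,
    ContinuousLinearMap.inl_apply, smul_eq_mul]
  have h2 : F (w, 0) = F (0, 1) * ((F (0, 1))⁻¹ * F (w, 0)) := by
    rw [mul_inv_cancel_left₀ hneg.ne]
  rw [h2] at h1
  have h3 : F (0, 1) * ((φ z + (F (0, 1))⁻¹ * F (w, 0) + ε) - α) ≤ 0 := by linarith
  have h4 := nonneg_of_mul_nonpos_right h3 hneg
  linarith

/-- Existence of a Lagrange multiplier for a linear functional on a closed convex set under a
strong quasi-relative interior condition. -/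
theorem exists_multiplier_of_sqriMem {Z W : Type*} [NormedAddCommGroup Z] [NormedSpace ℝ Z]
    [CompleteSpace Z] [NormedAddCommGroup W] [NormedSpace ℝ W] [CompleteSpace W]
    {C : Set (Z × W)} (hC : Convex ℝ C) (hcl : IsClosed C)
    (hsqri : sqriMem (Prod.snd '' C) (0 : W))
    (φ : Z →L[ℝ] ℝ) {α : ℝ} (hα : ∀ z, (z, (0 : W)) ∈ C → α ≤ φ z) :
    ∃ q : W →L[ℝ] ℝ, ∀ p ∈ C, α ≤ φ p.1 + q p.2 := by
  obtain ⟨⟨⟨z₀, w₀⟩, h₀, hw₀⟩, S, hS, hcone⟩ := hsqri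
  obtain rfl : w₀ = 0 := hw₀
  have hmem : ∀ w : W, w ∈ S ↔ ∃ t : ℝ, 0 ≤ t ∧ ∃ p ∈ C, t • p.2 = w := by
    intro w
    rw [← SetLike.mem_coe, ← hcone]
    simp only [sub_zero, Set.image_id', Set.mem_iUnion, Set.mem_Ici, Set.mem_smul_set,
      Set.mem_image, exists_exists_and_eq_and, exists_prop]
  have : CompleteSpace S := hS.completeSpace_coe
  let ι : Z × S →L[ℝ] Z × W := (ContinuousLinearMap.id ℝ Z).prodMap S.subtypeL
  obtain ⟨q, hq⟩ := exists_multiplier_of_absorbing (C := ι ⁻¹' C)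
    (hC.linear_preimage ι.toLinearMap) (hcl.preimage ι.continuous) (z₀ := z₀) h₀
    (fun w ↦ by
      obtain ⟨t, ht, p, hp, hpw⟩ := (hmem w).1 w.2
      rcases ht.eq_or_lt with rfl | ht
      · have hw : w = 0 := by ext; simpa using hpw.symm
        exact ⟨1, one_pos, z₀, by simpa [ι, hw] using h₀⟩
      · refine ⟨t⁻¹, inv_pos.2 ht, p.1, ?_⟩
        simpa [ι, ← hpw, smul_smul, inv_mul_cancel₀ ht.ne'] using hp)
    φ (α := α) (fun z hz ↦ hα z hz)
  obtain ⟨q', hq', -⟩ := exists_extension_norm_eq S q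
  refine ⟨q', fun p hp ↦ ?_⟩
  have hpS : p.2 ∈ S := (hmem _).2 ⟨1, zero_le_one, p, hp, one_smul _ _⟩
  have := hq (p.1, ⟨p.2, hpS⟩) hp
  rwa [← hq'] at this

/-- The real epigraph of an extended-real-valued function. -/
def realEpi {E : Type*} (f : E → EReal) : Set (E × ℝ) := {p | f p.1 ≤ (p.2 : EReal)}

theorem exists_mem_realEpi {E : Type*} {f : E → EReal} {x : E} (hx : f x ≠ ⊤) :
    ∃ t : ℝ, (x, t) ∈ realEpi f := by
  obtain ⟨t, ht, -⟩ := EReal.lt_iff_exists_real_btwn.1 hx.lt_top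
  exact ⟨t, ht.le⟩

theorem ne_top_of_mem_realEpi {E : Type*} {f : E → EReal} {p : E × ℝ} (hp : p ∈ realEpi f) :
    f p.1 ≠ ⊤ :=
  ne_top_of_le_ne_top (EReal.coe_ne_top _) hp

theorem coe_le_of_forall_mem_realEpi {E : Type*} {f : E → EReal} {x : E} {c : ℝ}
    (h : ∀ t : ℝ, (x, t) ∈ realEpi f → c ≤ t) : (c : EReal) ≤ f x :=
  EReal.le_of_forall_lt_iff_le.1 fun t ht ↦ EReal.coe_le_coe_iff.2 (h t ht.le)

theorem ProperConvLsc.isClosed_realEpi {E : Type*} [NormedAddCommGroup E]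
    [InnerProductSpace ℝ E] {f : E → EReal} (hf : ProperConvLsc f) : IsClosed (realEpi f) :=
  hf.2.2.2.isClosed_epigraph.preimage
    (continuous_fst.prodMk (continuous_coe_real_ereal.comp continuous_snd))

theorem ProperConvLsc.convex_realEpi {E : Type*} [NormedAddCommGroup E]
    [InnerProductSpace ℝ E] {f : E → EReal} (hf : ProperConvLsc f) : Convex ℝ (realEpi f) := by
  rintro ⟨x, s⟩ hx ⟨y, t⟩ hy a b ha hb hab
  have ha' : (0 : EReal) ≤ a := EReal.coe_nonneg.2 ha
  have hb' : (0 : EReal) ≤ b := EReal.coe_nonneg.2 hb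
  calc f (a • x + b • y) ≤ a * f x + b * f y := hf.2.2.1 x y a b ha hb hab
    _ ≤ a * s + b * t :=
      add_le_add (mul_le_mul_of_nonneg_left hx ha') (mul_le_mul_of_nonneg_left hy hb')
    _ = ((a * s + b * t : ℝ) : EReal) := by push_cast; rfl

section Conjugate

variable {E : Type*} [NormedAddCommGroup E] [InnerProductSpace ℝ E]

theorem econj_le_coe_iff {f : E → EReal} {p : E} {s : ℝ} :
    econj f p ≤ s ↔ ∀ a ∈ realEpi f, ⟪p, a.1⟫ - s ≤ a.2 := by
  rw [econj, iSup_le_iff]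
  have key : ∀ x, ((⟪p, x⟫ : ℝ) : EReal) - f x ≤ s ↔ ((⟪p, x⟫ - s : ℝ) : EReal) ≤ f x := by
    intro x
    induction f x with
    | bot => simp [-EReal.coe_sub]
    | top => simp
    | coe c => norm_cast; constructor <;> intro h <;> linarith
  simp only [key]
  refine ⟨fun h a ha ↦ ?_, fun h x ↦ coe_le_of_forall_mem_realEpi fun t ht ↦ h (x, t) ht⟩
  exact EReal.coe_le_coe_iff.1 ((h a.1).trans ha)

theorem mem_edom_econj_iff {f : E → EReal} {p : E} :
    p ∈ edom (econj f) ↔ ∃ s : ℝ, ∀ a ∈ realEpi f, ⟪p, a.1⟫ - s ≤ a.2 := by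
  simp only [← econj_le_coe_iff]
  exact ⟨exists_mem_realEpi, fun ⟨s, hs⟩ ↦ ne_top_of_mem_realEpi (p := (p, s)) hs⟩

theorem mem_esubdiff_of_forall_mem_realEpi {f : E → EReal} {x p : E} {s : ℝ} (hs : f x = s)
    (h : ∀ a ∈ realEpi f, s + ⟪p, a.1 - x⟫ ≤ a.2) : p ∈ esubdiff f x := by
  refine ⟨by simp [hs], by simp [hs], fun y ↦ ?_⟩
  rw [hs, ← EReal.coe_add]
  exact coe_le_of_forall_mem_realEpi fun t ht ↦ h (y, t) ht

/-- The Fenchel–Moreau theorem: a function with closed convex epigraph and at least one continuous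
affine minorant is the supremum of its continuous affine minorants. -/
theorem le_of_forall_affine_minorant_le [CompleteSpace E] {f : E → EReal}
    (hcl : IsClosed (realEpi f)) (hconv : Convex ℝ (realEpi f)) (hne : (realEpi f).Nonempty)
    {p₀ : E} {s₀ : ℝ} (h₀ : ∀ a ∈ realEpi f, ⟪p₀, a.1⟫ - s₀ ≤ a.2) {y : E} {β : ℝ}
    (h : ∀ (p : E) (s : ℝ), (∀ a ∈ realEpi f, ⟪p, a.1⟫ - s ≤ a.2) → ⟪p, y⟫ - s ≤ β) :
    f y ≤ β := by
  by_contra hy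
  obtain ⟨F, u, hF, hFu⟩ := geometric_hahn_banach_closed_point hconv hcl (x := (y, β)) hy
  obtain ⟨a, ha⟩ : ∃ a : E, ∀ x, F (x, 0) = ⟪a, x⟫ :=
    ⟨(InnerProductSpace.toDual ℝ E).symm (F.comp (ContinuousLinearMap.inl ℝ E ℝ)), fun x ↦ by
      rw [InnerProductSpace.toDual_symm_apply]; rfl⟩
  set γ : ℝ := F (0, 1) with hγ
  have hsplit : ∀ (x : E) (t : ℝ), F (x, t) = ⟪a, x⟫ + t * γ := by
    intro x t
    have : ((x, t) : E × ℝ) = (x, 0) + t • (0, 1) := by simp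
    rw [this, map_add, map_smul, smul_eq_mul, ha]
  have hF' : ∀ b ∈ realEpi f, ⟪a, b.1⟫ + b.2 * γ < u := fun b hb ↦ by
    rw [← hsplit]; exact hF b hb
  rw [hsplit] at hFu
  have hγ0 : γ ≤ 0 := by
    by_contra! hpos
    obtain ⟨⟨x, t⟩, hx⟩ := hne
    set k : ℝ := max t ((u - ⟪a, x⟫) / γ) with hk
    have hmem : (x, k) ∈ realEpi f :=
      le_trans (show f x ≤ t from hx) (EReal.coe_le_coe_iff.2 (le_max_left _ _))
    have h1 := hF' _ hmem
    have h2 : (u - ⟪a, x⟫) / γ ≤ k := le_max_right _ _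
    rw [div_le_iff₀ hpos] at h2
    simp only at h1
    linarith
  rcases hγ0.lt_or_eq with hneg | hzero
  · have hpos : 0 < -γ := by linarith
    have h1 := h ((-γ)⁻¹ • a) ((-γ)⁻¹ * u) (fun b hb ↦ by
      rw [real_inner_smul_left, ← mul_sub, inv_mul_le_iff₀ hpos]
      linarith [hF' b hb])
    rw [real_inner_smul_left, ← mul_sub, inv_mul_le_iff₀ hpos] at h1
    linarith
  · simp only [hzero, mul_zero, add_zero] at hF' hFu
    have hd : 0 < ⟪a, y⟫ - u := by linarith
    set k : ℝ := (|β - (⟪p₀, y⟫ - s₀)| + 1) / (⟪a, y⟫ - u) with hk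
    have hk0 : 0 ≤ k := by positivity
    have h1 := h (p₀ + k • a) (s₀ + k * u) (fun b hb ↦ by
      rw [inner_add_left, real_inner_smul_left]
      have := mul_le_mul_of_nonneg_left (hF' b hb).le hk0
      linarith [h₀ b hb])
    rw [inner_add_left, real_inner_smul_left] at h1
    have h2 : k * (⟪a, y⟫ - u) = |β - (⟪p₀, y⟫ - s₀)| + 1 := div_mul_cancel₀ _ hd.ne'
    linarith [le_abs_self (β - (⟪p₀, y⟫ - s₀))]

theorem coe_le_einfConv {f g : E → EReal} {p : E} {s t : ℝ}
    (hf : ∀ a ∈ realEpi f, ⟪p, a.1⟫ - s ≤ a.2) (hg : ∀ a ∈ realEpi g, ⟪p, a.1⟫ - t ≤ a.2)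
    (x : E) : ((⟪p, x⟫ - s - t : ℝ) : EReal) ≤ einfConv f g x := by
  refine le_iInf fun y ↦ ?_
  have h1 : ((⟪p, y⟫ - s : ℝ) : EReal) ≤ f y :=
    coe_le_of_forall_mem_realEpi fun r hr ↦ hf (y, r) hr
  have h2 : ((⟪p, x - y⟫ - t : ℝ) : EReal) ≤ g (x - y) :=
    coe_le_of_forall_mem_realEpi fun r hr ↦ hg (x - y, r) hr
  refine le_trans (le_of_eq ?_) (add_le_add h1 h2)
  rw [← EReal.coe_add, inner_sub_right]
  congr 1
  ring

open Pointwise in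
theorem exists_common_slope {f g : E → EReal}
    (h : sqriMem (edom (econj f) - edom (econj g)) (0 : E)) :
    ∃ (p : E) (s t : ℝ), (∀ a ∈ realEpi f, ⟪p, a.1⟫ - s ≤ a.2) ∧
      ∀ a ∈ realEpi g, ⟪p, a.1⟫ - t ≤ a.2 := by
  obtain ⟨p, hp, p', hp', hpp⟩ := Set.mem_sub.1 h.1
  obtain rfl : p = p' := sub_eq_zero.1 hpp
  obtain ⟨s, hs⟩ := mem_edom_econj_iff.1 hp
  obtain ⟨t, ht⟩ := mem_edom_econj_iff.1 hp'
  exact ⟨p, s, t, hs, ht⟩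

open Pointwise in
/-- Attouch–Brezis: under a strong quasi-relative interior condition on the domains of the
conjugates, the infimal convolution is exact. -/
theorem exists_add_le_of_einfConv_le [CompleteSpace E] {f g : E → EReal}
    (hfcl : IsClosed (realEpi f)) (hfconv : Convex ℝ (realEpi f)) (hfne : (realEpi f).Nonempty)
    (hgcl : IsClosed (realEpi g)) (hgconv : Convex ℝ (realEpi g)) (hgne : (realEpi g).Nonempty)
    (hs : sqriMem (edom (econj f) - edom (econj g)) (0 : E)) {x : E} {β : ℝ}
    (hβ : einfConv f g x ≤ β) : ∃ y, f (x - y) + g y ≤ β := by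
  let C : Set ((E × ℝ × ℝ) × E) := {c | (∀ a ∈ realEpi f, ⟪c.1.1, a.1⟫ - c.1.2.1 ≤ a.2) ∧
    ∀ a ∈ realEpi g, ⟪c.1.1 - c.2, a.1⟫ - c.1.2.2 ≤ a.2}
  have hCcl : IsClosed C := by
    simp only [C, Set.ofPred_and, Set.ofPred_forall]
    refine IsClosed.inter ?_ ?_ <;>
    exact isClosed_iInter fun a ↦ isClosed_iInter fun _ ↦
      isClosed_le (by fun_prop) continuous_const
  have hCconv : Convex ℝ C := by
    rintro c ⟨hc1, hc2⟩ d ⟨hd1, hd2⟩ a b ha hb hab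
    refine ⟨fun e he ↦ ?_, fun e he ↦ ?_⟩
    · have h1 := mul_le_mul_of_nonneg_left (hc1 e he) ha
      have h2 := mul_le_mul_of_nonneg_left (hd1 e he) hb
      have h3 : a * e.2 + b * e.2 = e.2 := by rw [← add_mul, hab, one_mul]
      simp only [Prod.fst_add, Prod.snd_add, Prod.smul_fst, Prod.smul_snd, inner_add_left,
        real_inner_smul_left, smul_eq_mul]
      linarith
    · have h1 := mul_le_mul_of_nonneg_left (hc2 e he) ha
      have h2 := mul_le_mul_of_nonneg_left (hd2 e he) hb
      have h3 : a * e.2 + b * e.2 = e.2 := by rw [← add_mul, hab, one_mul]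
      simp only [Prod.fst_add, Prod.snd_add, Prod.smul_fst, Prod.smul_snd, inner_add_left,
        inner_sub_left, real_inner_smul_left, smul_eq_mul] at h1 h2 ⊢
      linarith
  have himage : Prod.snd '' C = edom (econj f) - edom (econj g) := by
    ext w
    simp only [Set.mem_image, Set.mem_sub, mem_edom_econj_iff]
    constructor
    · rintro ⟨⟨⟨p, s, t⟩, w⟩, ⟨h1, h2⟩, rfl⟩
      exact ⟨p, ⟨s, h1⟩, p - w, ⟨t, h2⟩, sub_sub_cancel _ _⟩
    · rintro ⟨p, ⟨s, h1⟩, p', ⟨t, h2⟩, rfl⟩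
      exact ⟨((p, s, t), p - p'), ⟨h1, by simpa using h2⟩, rfl⟩
  obtain ⟨p₀, s₀, t₀, hs₀, ht₀⟩ := exists_common_slope hs
  rw [← himage] at hs
  let φ : E × ℝ × ℝ →L[ℝ] ℝ :=
    (ContinuousLinearMap.fst ℝ ℝ ℝ + ContinuousLinearMap.snd ℝ ℝ ℝ).comp
      (ContinuousLinearMap.snd ℝ E (ℝ × ℝ)) -
    (innerSL ℝ x).comp (ContinuousLinearMap.fst ℝ E (ℝ × ℝ))
  have hφ : ∀ p s t, φ (p, s, t) = s + t - ⟪p, x⟫ := fun p s t ↦ by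
    simp [φ, real_inner_comm]
  obtain ⟨q, hq⟩ := exists_multiplier_of_sqriMem hCconv hCcl hs φ (α := -β) (by
    rintro ⟨p, s, t⟩ ⟨h1, h2⟩
    have := EReal.coe_le_coe_iff.1
      ((coe_le_einfConv h1 (by simpa using h2) x).trans hβ)
    rw [hφ]
    linarith)
  set y : E := (InnerProductSpace.toDual ℝ E).symm q with hy
  have hqy : ∀ w, q w = ⟪w, y⟫ := fun w ↦ by
    rw [real_inner_comm, hy, InnerProductSpace.toDual_symm_apply]
  have key : ∀ p s p' t, (∀ a ∈ realEpi f, ⟪p, a.1⟫ - s ≤ a.2) →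
      (∀ a ∈ realEpi g, ⟪p', a.1⟫ - t ≤ a.2) → (⟪p, x - y⟫ - s) + (⟪p', y⟫ - t) ≤ β := by
    intro p s p' t h1 h2
    have := hq ((p, s, t), p - p') ⟨h1, by simpa using h2⟩
    rw [hφ, hqy, inner_sub_left] at this
    rw [inner_sub_right]
    linarith
  refine ⟨y, ?_⟩
  have hfy : ∀ p' t, (∀ a ∈ realEpi g, ⟪p', a.1⟫ - t ≤ a.2) →
      f (x - y) ≤ ((β - (⟪p', y⟫ - t) : ℝ) : EReal) := fun p' t h2 ↦
    le_of_forall_affine_minorant_le hfcl hfconv hfne hs₀ fun p s h1 ↦ by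
      linarith [key p s p' t h1 h2]
  have hbot : ((⟪p₀, x - y⟫ - s₀ : ℝ) : EReal) ≤ f (x - y) :=
    coe_le_of_forall_mem_realEpi fun r hr ↦ hs₀ (x - y, r) hr
  obtain ⟨c, hc⟩ : ∃ c : ℝ, f (x - y) = c :=
    ⟨_, (EReal.coe_toReal (ne_top_of_le_ne_top (EReal.coe_ne_top _) (hfy p₀ t₀ ht₀))
      (ne_bot_of_le_ne_bot (EReal.coe_ne_bot _) hbot)).symm⟩
  have hgy : g y ≤ ((β - c : ℝ) : EReal) :=
    le_of_forall_affine_minorant_le hgcl hgconv hgne ht₀ fun p' t h2 ↦ by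
      have := hfy p' t h2
      rw [hc, EReal.coe_le_coe_iff] at this
      linarith
  calc f (x - y) + g y ≤ (c : EReal) + ((β - c : ℝ) : EReal) := add_le_add hc.le hgy
    _ = β := by rw [← EReal.coe_add, add_sub_cancel]

end Conjugate

theorem EReal.coe_finset_sum {ι : Type*} (s : Finset ι) (a : ι → ℝ) :
    ((∑ i ∈ s, a i : ℝ) : EReal) = ∑ i ∈ s, (a i : EReal) := by
  classical
  induction s using Finset.induction_on with
  | empty => simp
  | insert i s hi ih => rw [Finset.sum_insert hi, Finset.sum_insert hi, EReal.coe_add, ih]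

theorem EReal.finset_sum_ne_bot {ι : Type*} {s : Finset ι} {a : ι → EReal}
    (h : ∀ i ∈ s, a i ≠ ⊥) : ∑ i ∈ s, a i ≠ ⊥ :=
  Finset.sum_induction a (· ≠ ⊥) (fun _ _ hx hy ↦ by simp [hx, hy]) (by simp) h

theorem EReal.ne_top_of_finset_sum_ne_top {ι : Type*} {s : Finset ι} {a : ι → EReal}
    (h : ∀ i ∈ s, a i ≠ ⊥) (hs : ∑ i ∈ s, a i ≠ ⊤) {i : ι} (hi : i ∈ s) : a i ≠ ⊤ := by
  classical
  intro hai
  rw [← Finset.add_sum_erase s a hi, hai] at hs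
  exact hs (EReal.top_add_of_ne_bot
    (EReal.finset_sum_ne_bot fun j hj ↦ h j (Finset.mem_of_mem_erase hj)))

theorem EReal.exists_coe_of_add_ne_top {a b : EReal} (ha : a ≠ ⊥) (hb : b ≠ ⊥)
    (h : a + b ≠ ⊤) : (∃ x : ℝ, a = x) ∧ ∃ y : ℝ, b = y := by
  have ha' : a ≠ ⊤ := fun hat ↦ h (by rw [hat, EReal.top_add_of_ne_bot hb])
  have hb' : b ≠ ⊤ := fun hbt ↦ h (by rw [hbt, EReal.add_top_of_ne_bot ha])
  exact ⟨⟨_, (EReal.coe_toReal ha' ha).symm⟩, ⟨_, (EReal.coe_toReal hb' hb).symm⟩⟩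

/-- First-order optimality for the sum of a linear functional and a differentiable function,
on a convex set. -/
theorem Convex.le_linearization_of_isMinOn {Z : Type*} [NormedAddCommGroup Z] [NormedSpace ℝ Z]
    {D : Set Z} (hD : Convex ℝ D) {θ : Z → ℝ} {φ : Z →L[ℝ] ℝ} {z₀ z : Z}
    (hθ : HasFDerivAt θ φ z₀) (hmin : ∀ z ∈ D, θ z₀ ≤ θ z) (hz₀ : z₀ ∈ D) (hz : z ∈ D) :
    φ z₀ ≤ φ z := by
  have h := IsLocalMinOn.hasFDerivWithinAt_nonneg
    (IsMinOn.localize (show IsMinOn θ D z₀ from hmin)) hθ.hasFDerivWithinAt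
    (sub_mem_posTangentConeAt_of_segment_subset (hD.segment_subset hz₀ hz))
  rw [map_sub] at h
  linarith

/-- A continuous linear functional on a finite product of Hilbert spaces is given by
componentwise inner products. -/
theorem exists_forall_eq_sum_inner {ι : Type*} [Fintype ι] [DecidableEq ι] {X : ι → Type*}
    [∀ i, NormedAddCommGroup (X i)] [∀ i, InnerProductSpace ℝ (X i)] [∀ i, CompleteSpace (X i)]
    (q : (∀ i, X i) →L[ℝ] ℝ) : ∃ v : ∀ i, X i, ∀ p, q p = ∑ i, ⟪v i, p i⟫ := by
  refine ⟨fun i ↦ (InnerProductSpace.toDual ℝ (X i)).symm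
    (q.comp (ContinuousLinearMap.single ℝ X i)), fun p ↦ ?_⟩
  simp only [InnerProductSpace.toDual_symm_apply, ContinuousLinearMap.comp_apply,
    ContinuousLinearMap.single_apply]
  rw [← map_sum, Finset.univ_sum_single]

theorem sum_inner_single {ι : Type*} [Fintype ι] [DecidableEq ι] {X : ι → Type*}
    [∀ i, NormedAddCommGroup (X i)] [∀ i, InnerProductSpace ℝ (X i)]
    (v : ∀ i, X i) (i : ι) (e : X i) : ∑ j, ⟪v j, (Pi.single i e : ∀ j, X j) j⟫ = ⟪v i, e⟫ := by
  rw [Finset.sum_eq_single i (fun j _ hj ↦ by rw [Pi.single_eq_of_ne hj, inner_zero_right])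
    (by simp), Pi.single_eq_same]

section InfConvProblem

variable {m : ℕ}
    {H : Type*} [NormedAddCommGroup H] [InnerProductSpace ℝ H]
    {G : Fin m → Type*} [∀ i, NormedAddCommGroup (G i)] [∀ i, InnerProductSpace ℝ (G i)]
    {X : Fin m → Type*} [∀ i, NormedAddCommGroup (X i)] [∀ i, InnerProductSpace ℝ (X i)]
    {Y : Fin m → Type*} [∀ i, NormedAddCommGroup (Y i)] [∀ i, InnerProductSpace ℝ (Y i)]

/-- The graph-type constraint set obtained by splitting the infimal convolutions, with epigraphical
variables, and perturbing the arguments of the composite functions. -/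
def splitSet (f : H → EReal) (r : ∀ i, G i) (g : ∀ i, X i → EReal) (l : ∀ i, Y i → EReal)
    (L : ∀ i, H →L[ℝ] G i) (K : ∀ i, G i →L[ℝ] X i) (M : ∀ i, G i →L[ℝ] Y i) :
    Set (((H × ∀ i, G i) × ℝ × (Fin m → ℝ) × (Fin m → ℝ)) × (∀ i, X i) × ∀ i, Y i) :=
  {c | (c.1.1.1, c.1.2.1) ∈ realEpi f ∧
    (∀ i, (K i (L i c.1.1.1 - r i - c.1.1.2 i) - c.2.1 i, c.1.2.2.1 i) ∈ realEpi (g i)) ∧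
    ∀ i, (M i (c.1.1.2 i) - c.2.2 i, c.1.2.2.2 i) ∈ realEpi (l i)}

variable {f : H → EReal} {r : ∀ i, G i} {g : ∀ i, X i → EReal} {l : ∀ i, Y i → EReal}
    {L : ∀ i, H →L[ℝ] G i} {K : ∀ i, G i →L[ℝ] X i} {M : ∀ i, G i →L[ℝ] Y i}

theorem isClosed_splitSet (hf : ProperConvLsc f) (hg : ∀ i, ProperConvLsc (g i))
    (hl : ∀ i, ProperConvLsc (l i)) : IsClosed (splitSet f r g l L K M) := by
  simp only [splitSet, Set.ofPred_and, Set.ofPred_forall]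
  refine (hf.isClosed_realEpi.preimage (by fun_prop)).inter
    ((isClosed_iInter fun i ↦ (hg i).isClosed_realEpi.preimage (by fun_prop)).inter
      (isClosed_iInter fun i ↦ (hl i).isClosed_realEpi.preimage (by fun_prop)))

theorem convex_splitSet (hf : ProperConvLsc f) (hg : ∀ i, ProperConvLsc (g i))
    (hl : ∀ i, ProperConvLsc (l i)) : Convex ℝ (splitSet f r g l L K M) := by
  rintro c ⟨hcf, hcg, hcl⟩ d ⟨hdf, hdg, hdl⟩ a b ha hb hab
  refine ⟨hf.convex_realEpi hcf hdf ha hb hab, fun i ↦ ?_, fun i ↦ ?_⟩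
  · convert (hg i).convex_realEpi (hcg i) (hdg i) ha hb hab using 1
    obtain rfl : b = 1 - a := by linarith
    ext
    · simp only [Prod.fst_add, Prod.snd_add, Prod.smul_fst, Prod.smul_snd, map_add, map_sub,
        map_smul, Pi.add_apply, Pi.smul_apply]
      module
    · rfl
  · convert (hl i).convex_realEpi (hcl i) (hdl i) ha hb hab using 1
    ext
    · simp only [Prod.fst_add, Prod.snd_add, Prod.smul_fst, Prod.smul_snd, map_add,
        map_smul, Pi.add_apply, Pi.smul_apply]
      module
    · rfl

theorem snd_image_splitSet : Prod.snd '' splitSet f r g l L K M =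
    {e : (∀ i, X i) × (∀ i, Y i) |
        ∃ (x : H) (y : ∀ i, G i) (u : ∀ i, X i) (w : ∀ i, Y i),
          f x ≠ ⊤ ∧ (∀ i, g i (u i) ≠ ⊤) ∧ (∀ i, l i (w i) ≠ ⊤) ∧
          e = (fun i => K i (L i x - r i - y i) - u i, fun i => M i (y i) - w i)} := by
  ext e
  constructor
  · rintro ⟨⟨⟨⟨x, y⟩, s, a, b⟩, p, q⟩, ⟨hf, hg, hl⟩, rfl⟩
    refine ⟨x, y, fun i ↦ K i (L i x - r i - y i) - p i, fun i ↦ M i (y i) - q i,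
      ne_top_of_mem_realEpi hf, fun i ↦ ne_top_of_mem_realEpi (hg i),
      fun i ↦ ne_top_of_mem_realEpi (hl i), ?_⟩
    simp
  · rintro ⟨x, y, u, w, hf, hg, hl, rfl⟩
    obtain ⟨s, hs⟩ := exists_mem_realEpi hf
    choose a ha using fun i ↦ exists_mem_realEpi (hg i)
    choose b hb using fun i ↦ exists_mem_realEpi (hl i)
    exact ⟨(((x, y), s, a, b), _), ⟨hs, fun i ↦ by simpa using ha i, fun i ↦ by simpa using hb i⟩,
      rfl⟩

/-- The linearized objective of the split problem. -/
def splitObjective (c : H) : ((H × ∀ i, G i) × ℝ × (Fin m → ℝ) × (Fin m → ℝ)) →L[ℝ] ℝ :=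
  (innerSL ℝ c).comp ((ContinuousLinearMap.fst ℝ H (∀ i, G i)).comp
    (ContinuousLinearMap.fst ℝ (H × ∀ i, G i) (ℝ × (Fin m → ℝ) × (Fin m → ℝ)))) +
  (ContinuousLinearMap.fst ℝ ℝ ((Fin m → ℝ) × (Fin m → ℝ)) +
    ∑ i, (ContinuousLinearMap.proj (R := ℝ) (φ := fun _ : Fin m ↦ ℝ) i).comp
      ((ContinuousLinearMap.fst ℝ (Fin m → ℝ) (Fin m → ℝ) +
        ContinuousLinearMap.snd ℝ (Fin m → ℝ) (Fin m → ℝ)).comp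
        (ContinuousLinearMap.snd ℝ ℝ ((Fin m → ℝ) × (Fin m → ℝ))))).comp
    (ContinuousLinearMap.snd ℝ (H × ∀ i, G i) (ℝ × (Fin m → ℝ) × (Fin m → ℝ)))

theorem splitObjective_apply (c : H) (x : H) (y : ∀ i, G i) (s : ℝ) (a b : Fin m → ℝ) :
    splitObjective c ((x, y), s, a, b) = ⟪c, x⟫ + (s + ∑ i, (a i + b i)) := by
  simp [splitObjective, sum_apply]

theorem hasFDerivAt_splitObjective [CompleteSpace H] {h : H → ℝ} {v x z : H}
    (hv : HasGradientAt h v x) (y : ∀ i, G i) (s : ℝ) (a b : Fin m → ℝ) :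
    HasFDerivAt (fun d : (H × ∀ i, G i) × ℝ × (Fin m → ℝ) × (Fin m → ℝ) ↦
      splitObjective (-z) d + h d.1.1) (splitObjective (v - z)) ((x, y), s, a, b) := by
  have hfst : HasFDerivAt (fun d : (H × ∀ i, G i) × ℝ × (Fin m → ℝ) × (Fin m → ℝ) ↦ d.1.1)
      ((ContinuousLinearMap.fst ℝ H (∀ i, G i)).comp
        (ContinuousLinearMap.fst ℝ (H × ∀ i, G i) (ℝ × (Fin m → ℝ) × (Fin m → ℝ))))
      ((x, y), s, a, b) :=
    hasFDerivAt_fst.comp _ hasFDerivAt_fst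
  refine ((splitObjective (-z)).hasFDerivAt.add
    (HasFDerivAt.comp (g := h) _ hv.hasFDerivAt hfst)).congr_fderiv ?_
  refine ContinuousLinearMap.ext fun d ↦ ?_
  rcases d with ⟨⟨x', y'⟩, s', a', b'⟩
  rw [add_apply, splitObjective_apply, splitObjective_apply]
  simp only [ContinuousLinearMap.comp_apply, ContinuousLinearMap.coe_fst',
    InnerProductSpace.toDual_apply_apply, inner_sub_left, inner_neg_left]
  ring

end InfConvProblem

open Pointwise in
theorem stmt10 {m : ℕ}
    {H : Type*} [NormedAddCommGroup H] [InnerProductSpace ℝ H] [CompleteSpace H]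
    {G : Fin m → Type*} [∀ i, NormedAddCommGroup (G i)] [∀ i, InnerProductSpace ℝ (G i)]
    [∀ i, CompleteSpace (G i)]
    {X : Fin m → Type*} [∀ i, NormedAddCommGroup (X i)] [∀ i, InnerProductSpace ℝ (X i)]
    [∀ i, CompleteSpace (X i)]
    {Y : Fin m → Type*} [∀ i, NormedAddCommGroup (Y i)] [∀ i, InnerProductSpace ℝ (Y i)]
    [∀ i, CompleteSpace (Y i)]
    (z : H)
    (f : H → EReal) (hf : ProperConvLsc f)
    (μ : ℝ) (hμ : 0 < μ)
    (h : H → ℝ) (hh : ProperConvLsc (fun x => (h x : EReal)))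
    (h' : H → H) (hgrad : ∀ x, HasGradientAt h (h' x) x)
    (hlip : ∀ x y : H, ‖h' x - h' y‖ ≤ μ * ‖x - y‖)
    (r : ∀ i, G i)
    (g : ∀ i, X i → EReal) (hg : ∀ i, ProperConvLsc (g i))
    (l : ∀ i, Y i → EReal) (hl : ∀ i, ProperConvLsc (l i))
    (L : ∀ i, H →L[ℝ] G i) (hL : ∀ i, L i ≠ 0)
    (K : ∀ i, G i →L[ℝ] X i) (hK : ∀ i, K i ≠ 0)
    (M : ∀ i, G i →L[ℝ] Y i) (hM : ∀ i, M i ≠ 0)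
    -- (P) has an optimal solution
    (hopt : ∃ xb : H, ∀ x : H,
      f xb + (∑ i, einfConv (fun w => g i (K i w)) (fun w => l i (M i w)) (L i xb - r i)) +
          ((h xb - ⟪xb, z⟫ : ℝ) : EReal) ≤
        f x + (∑ i, einfConv (fun w => g i (K i w)) (fun w => l i (M i w)) (L i x - r i)) +
          ((h x - ⟪x, z⟫ : ℝ) : EReal))
    -- `0 ∈ sqri(dom (gᵢ ∘ Kᵢ)* − dom (lᵢ ∘ Mᵢ)*)`
    (hsqri1 : ∀ i, sqriMem
      (edom (econj (fun w => g i (K i w))) - edom (econj (fun w => l i (M i w)))) (0 : G i))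
    -- `0 ∈ sqri E`
    (hsqri2 : sqriMem
      {e : (∀ i, X i) × (∀ i, Y i) |
        ∃ (x : H) (y : ∀ i, G i) (u : ∀ i, X i) (w : ∀ i, Y i),
          f x ≠ ⊤ ∧ (∀ i, g i (u i) ≠ ⊤) ∧ (∀ i, l i (w i) ≠ ⊤) ∧
          e = (fun i => K i (L i x - r i - y i) - u i, fun i => M i (y i) - w i)}
      (0 : (∀ i, X i) × (∀ i, Y i))) :
    ∃ (x : H) (u : H) (w : ∀ i, G i), u ∈ esubdiff f x ∧
      (∀ i, w i ∈ parOp (compOp (K i) (esubdiff (g i))) (compOp (M i) (esubdiff (l i)))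
        (L i x - r i)) ∧
      z = u + ∑ i, ContinuousLinearMap.adjoint (L i) (w i) + h' x := by
  -- A feasible point shows that all the data of the problem are proper.
  obtain ⟨⟨x₁, y₁, u₁, w₁, hfx₁, hgu₁, hlw₁, he₁⟩, -⟩ := id hsqri2
  have hKy : ∀ i, K i (L i x₁ - r i - y₁ i) = u₁ i := fun i ↦ by
    have := congrFun (congrArg Prod.fst he₁) i
    exact sub_eq_zero.1 this.symm
  have hMy : ∀ i, M i (y₁ i) = w₁ i := fun i ↦ by
    have := congrFun (congrArg Prod.snd he₁) i
    exact sub_eq_zero.1 this.symm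
  have hbot : ∀ i x, einfConv (fun w => g i (K i w)) (fun w => l i (M i w)) x ≠ ⊥ := by
    intro i x
    obtain ⟨p, s, t, hs, ht⟩ := exists_common_slope (hsqri1 i)
    exact ne_bot_of_le_ne_bot (EReal.coe_ne_bot _) (coe_le_einfConv hs ht x)
  have hle : ∀ i x y, einfConv (fun w => g i (K i w)) (fun w => l i (M i w)) x ≤
      g i (K i (x - y)) + l i (M i y) := fun i x y ↦
    (iInf_le _ (x - y)).trans (by rw [sub_sub_cancel])
  obtain ⟨xb, hxb⟩ := hopt
  -- The optimal value, restricted to real bounds on all the terms.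
  have hreal : ∀ (x : H) (y : ∀ i, G i) (s : ℝ) (a b : Fin m → ℝ), f x ≤ s →
      (∀ i, g i (K i (L i x - r i - y i)) ≤ a i) → (∀ i, l i (M i (y i)) ≤ b i) →
      f xb + (∑ i, einfConv (fun w => g i (K i w)) (fun w => l i (M i w)) (L i xb - r i)) +
          ((h xb - ⟪xb, z⟫ : ℝ) : EReal) ≤
        ((s + ∑ i, (a i + b i) + (h x - ⟪x, z⟫) : ℝ) : EReal) := by
    intro x y s a b hs ha hb
    refine (hxb x).trans ?_
    rw [EReal.coe_add, EReal.coe_add, EReal.coe_finset_sum]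
    gcongr with i
    exact (hle i _ (y i)).trans (by rw [EReal.coe_add]; exact add_le_add (ha i) (hb i))
  obtain ⟨s₁, hs₁⟩ := exists_mem_realEpi hfx₁
  choose a₁ ha₁ using fun i ↦ exists_mem_realEpi (hgu₁ i)
  choose b₁ hb₁ using fun i ↦ exists_mem_realEpi (hlw₁ i)
  have hfin := ne_top_of_le_ne_top (EReal.coe_ne_top _)
    (hreal x₁ y₁ s₁ a₁ b₁ hs₁ (fun i ↦ by rw [hKy]; exact ha₁ i)
      (fun i ↦ by rw [hMy]; exact hb₁ i))
  have hsumbot := EReal.finset_sum_ne_bot (s := Finset.univ) (fun i _ ↦ hbot i (L i xb - r i))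
  obtain ⟨⟨v, hv⟩, -⟩ := EReal.exists_coe_of_add_ne_top
    (by simp [hf.2.1, hsumbot]) (EReal.coe_ne_bot _) hfin
  obtain ⟨⟨s, hs⟩, ⟨σ, hσ⟩⟩ := EReal.exists_coe_of_add_ne_top (hf.2.1 xb) hsumbot
    (by rw [hv]; exact EReal.coe_ne_top _)
  have hex : ∀ i, ∃ β : ℝ,
      einfConv (fun w => g i (K i w)) (fun w => l i (M i w)) (L i xb - r i) = β := fun i ↦
    ⟨_, (EReal.coe_toReal (EReal.ne_top_of_finset_sum_ne_top
      (fun i _ ↦ hbot i (L i xb - r i)) (by rw [hσ]; exact EReal.coe_ne_top _)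
      (Finset.mem_univ i)) (hbot i _)).symm⟩
  choose β hβ using hex
  -- Exactness of the infimal convolutions at the optimal point.
  have hexact : ∀ i, ∃ y, g i (K i (L i xb - r i - y)) + l i (M i y) ≤ β i := by
    intro i
    let κ : G i × ℝ →L[ℝ] X i × ℝ := (K i).prodMap (ContinuousLinearMap.id ℝ ℝ)
    let ν : G i × ℝ →L[ℝ] Y i × ℝ := (M i).prodMap (ContinuousLinearMap.id ℝ ℝ)
    exact exists_add_le_of_einfConv_le (f := fun w => g i (K i w)) (g := fun w => l i (M i w))
      ((hg i).isClosed_realEpi.preimage κ.continuous)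
      ((hg i).convex_realEpi.linear_preimage κ.toLinearMap)
      ⟨(L i x₁ - r i - y₁ i, a₁ i), by simpa [realEpi, hKy] using ha₁ i⟩
      ((hl i).isClosed_realEpi.preimage ν.continuous)
      ((hl i).convex_realEpi.linear_preimage ν.toLinearMap)
      ⟨(y₁ i, b₁ i), by simpa [realEpi, hMy] using hb₁ i⟩
      (hsqri1 i) (hβ i).le
  choose y hy using hexact
  have hab := fun i ↦ EReal.exists_coe_of_add_ne_top ((hg i).2.1 _) ((hl i).2.1 _)
    (ne_top_of_le_ne_top (EReal.coe_ne_top _) (hy i))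
  choose a ha using fun i ↦ (hab i).1
  choose b hb using fun i ↦ (hab i).2
  have hβab : ∀ i, a i + b i ≤ β i := fun i ↦ by
    have := hy i
    rwa [ha, hb, ← EReal.coe_add, EReal.coe_le_coe_iff] at this
  -- The split problem and its Lagrange multipliers.
  have hconv : Convex ℝ (splitSet f r g l L K M) := convex_splitSet hf hg hl
  set z₀ : (H × ∀ i, G i) × ℝ × (Fin m → ℝ) × (Fin m → ℝ) := ((xb, y), s, a, b) with hz₀
  have hz₀mem : (z₀, 0) ∈ splitSet f r g l L K M :=
    ⟨hs.le, fun i ↦ by simpa [z₀, realEpi] using (ha i).le,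
      fun i ↦ by simpa [z₀, realEpi] using (hb i).le⟩
  have hmin : ∀ d ∈ {d | (d, 0) ∈ splitSet f r g l L K M},
      splitObjective (-z) z₀ + h z₀.1.1 ≤ splitObjective (-z) d + h d.1.1 := by
    rintro ⟨⟨x, y'⟩, s', a', b'⟩ ⟨h1, h2, h3⟩
    have := hreal x y' s' a' b' h1 (fun i ↦ by simpa [realEpi] using h2 i)
      (fun i ↦ by simpa [realEpi] using h3 i)
    simp only [hβ] at this
    rw [hs, ← EReal.coe_finset_sum, ← EReal.coe_add, ← EReal.coe_add,
      EReal.coe_le_coe_iff] at this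
    have hsum : ∑ i, (a i + b i) ≤ ∑ i, β i := Finset.sum_le_sum fun i _ ↦ hβab i
    simp only [hz₀, splitObjective_apply, inner_neg_left]
    rw [real_inner_comm xb z, real_inner_comm x z]
    linarith
  have hlin : ∀ d, (d, 0) ∈ splitSet f r g l L K M →
      splitObjective (h' xb - z) z₀ ≤ splitObjective (h' xb - z) d := fun d hd ↦
    Convex.le_linearization_of_isMinOn (D := {d | (d, 0) ∈ splitSet f r g l L K M})
      (hconv.linear_preimage (LinearMap.inl ℝ _ _))
      (hasFDerivAt_splitObjective (hgrad xb) y s a b) hmin hz₀mem hd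
  obtain ⟨q, hq⟩ := exists_multiplier_of_sqriMem hconv (isClosed_splitSet hf hg hl)
    (by rw [snd_image_splitSet]; exact hsqri2) (splitObjective (h' xb - z)) hlin
  obtain ⟨v, hv⟩ := exists_forall_eq_sum_inner (q.comp (ContinuousLinearMap.inl ℝ _ _))
  obtain ⟨ω, hω⟩ := exists_forall_eq_sum_inner (q.comp (ContinuousLinearMap.inr ℝ _ _))
  have key : ∀ (dx : H) (dy : ∀ i, G i) (ds : ℝ) (da db : Fin m → ℝ) (p : ∀ i, X i)
      (p' : ∀ i, Y i), f (xb + dx) ≤ ((s + ds : ℝ) : EReal) →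
      (∀ i, g i (K i (L i xb - r i - y i) + K i (L i dx - dy i) - p i) ≤
        ((a i + da i : ℝ) : EReal)) →
      (∀ i, l i (M i (y i) + M i (dy i) - p' i) ≤ ((b i + db i : ℝ) : EReal)) →
      0 ≤ ⟪h' xb - z, dx⟫ + ds + ∑ i, da i + ∑ i, db i + ∑ i, ⟪v i, p i⟫ + ∑ i, ⟪ω i, p' i⟫ := by
    intro dx dy ds da db p p' h1 h2 h3
    have hK' : ∀ i, K i (L i (xb + dx) - r i - (y + dy) i) - p i =
        K i (L i xb - r i - y i) + K i (L i dx - dy i) - p i := fun i ↦ by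
      simp only [map_add, map_sub, Pi.add_apply]
      abel
    have hM' : ∀ i, M i ((y + dy) i) - p' i = M i (y i) + M i (dy i) - p' i := fun i ↦ by
      rw [Pi.add_apply, map_add]
    have := hq (((xb + dx, y + dy), s + ds, a + da, b + db), p, p')
      ⟨h1, fun i ↦ (congrArg (g i) (hK' i)).le.trans (h2 i),
        fun i ↦ (congrArg (l i) (hM' i)).le.trans (h3 i)⟩
    have hqs : q (p, p') = ∑ i, ⟪v i, p i⟫ + ∑ i, ⟪ω i, p' i⟫ := by
      rw [← hv, ← hω, ContinuousLinearMap.comp_apply, ContinuousLinearMap.comp_apply, ← map_add]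
      simp
    simp only [hz₀, splitObjective_apply, hqs, Pi.add_apply, inner_add_right,
      Finset.sum_add_distrib] at this
    linarith
  have hpar : ∀ i, ContinuousLinearMap.adjoint (K i) (v i) =
      ContinuousLinearMap.adjoint (M i) (ω i) := by
    intro i
    set η := ContinuousLinearMap.adjoint (K i) (v i) - ContinuousLinearMap.adjoint (M i) (ω i)
      with hη
    have := key 0 (Pi.single i η) 0 0 0 (Pi.single i (-K i η)) (Pi.single i (M i η))
      (by simpa using hs.le)
      (fun j ↦ by
        rcases eq_or_ne j i with rfl | hj
        · simpa using (ha j).le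
        · simpa [hj] using (ha j).le)
      (fun j ↦ by
        rcases eq_or_ne j i with rfl | hj
        · simpa using (hb j).le
        · simpa [hj] using (hb j).le)
    rw [sum_inner_single, sum_inner_single, inner_neg_right,
      ← ContinuousLinearMap.adjoint_inner_left, ← ContinuousLinearMap.adjoint_inner_left] at this
    simp only [inner_zero_right, Pi.zero_apply, Finset.sum_const_zero, zero_add, add_zero] at this
    have h2 : ⟪η, η⟫ ≤ 0 := by
      nth_rw 1 [hη]
      rw [inner_sub_left]
      linarith
    exact sub_eq_zero.1 (real_inner_self_nonpos.1 h2)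
  have hvg : ∀ i, v i ∈ esubdiff (g i) (K i (L i xb - r i - y i)) := by
    intro i
    refine mem_esubdiff_of_forall_mem_realEpi (ha i) fun c hc ↦ ?_
    have := key 0 0 0 (Pi.single i (c.2 - a i)) 0
      (Pi.single i (K i (L i xb - r i - y i) - c.1)) 0
      (by simpa using hs.le)
      (fun j ↦ by
        rcases eq_or_ne j i with rfl | hj
        · simpa [-map_sub, realEpi] using hc
        · simpa [hj] using (ha j).le)
      (fun j ↦ by simpa using (hb j).le)
    rw [sum_inner_single, Finset.sum_pi_single'] at this
    simp only [inner_zero_right, Pi.zero_apply, Finset.sum_const_zero, zero_add, add_zero,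
      Finset.mem_univ, if_true] at this
    rw [← neg_sub, inner_neg_right]
    linarith
  have hωl : ∀ i, ω i ∈ esubdiff (l i) (M i (y i)) := by
    intro i
    refine mem_esubdiff_of_forall_mem_realEpi (hb i) fun c hc ↦ ?_
    have := key 0 0 0 0 (Pi.single i (c.2 - b i)) 0
      (Pi.single i (M i (y i) - c.1))
      (by simpa using hs.le)
      (fun j ↦ by simpa using (ha j).le)
      (fun j ↦ by
        rcases eq_or_ne j i with rfl | hj
        · simpa [realEpi] using hc
        · simpa [hj] using (hb j).le)
    rw [sum_inner_single, Finset.sum_pi_single'] at this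
    simp only [inner_zero_right, Pi.zero_apply, Finset.sum_const_zero, zero_add, add_zero,
      Finset.mem_univ, if_true] at this
    rw [← neg_sub, inner_neg_right]
    linarith
  refine ⟨xb, z - ∑ i, ContinuousLinearMap.adjoint (L i)
    (ContinuousLinearMap.adjoint (K i) (v i)) - h' xb,
    fun i ↦ ContinuousLinearMap.adjoint (K i) (v i), ?_, fun i ↦ ?_, by abel⟩
  · refine mem_esubdiff_of_forall_mem_realEpi hs fun c hc ↦ ?_
    have := key (c.1 - xb) 0 (c.2 - s) 0 0 (fun i ↦ K i (L i (c.1 - xb))) 0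
      (by simpa [realEpi] using hc)
      (fun i ↦ by simpa using (ha i).le)
      (fun i ↦ by simpa using (hb i).le)
    simp only [inner_zero_right, Pi.zero_apply, Finset.sum_const_zero, add_zero] at this
    rw [inner_sub_left, inner_sub_left, sum_inner]
    simp only [ContinuousLinearMap.adjoint_inner_left]
    rw [inner_sub_left] at this
    linarith
  · exact ⟨L i xb - r i - y i, ⟨v i, hvg i, rfl⟩, y i, ⟨ω i, hωl i, (hpar i).symm⟩,
      (sub_add_cancel _ _).symm⟩
end
end

section
/- Suppose (x̄, p̄, q̄, ȳ) ∈ H ⊕ X ⊕ Y ⊕ G satisfies the optimality system: z − Σ_{i=1}^m L_i* K_i* p̄_i ∈ ∂f(x̄) + ∇h(x̄), and for every i = 1,…,m, K_i(L_i x̄ − ȳ_i − r_i) ∈ ∂g_i*(p̄_i), M_i ȳ_i ∈ ∂l_i*(q̄_i) and K_i* p̄_i = M_i* q̄_i. Then x̄ is an optimal solution to the primal problem (P), (p̄, q̄) is an optimal solution to the dual problem (D), and the optimal values of (P) and (D) coincide. -/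
open scoped RealInnerProductSpace ENNReal
open Filter Topology

noncomputable section

/-- the objective value of the primal problem (P) -/
def Pval {m : ℕ}
    {H : Type*} [NormedAddCommGroup H] [InnerProductSpace ℝ H] [CompleteSpace H]
    {G : Fin m → Type*} [∀ i, NormedAddCommGroup (G i)] [∀ i, InnerProductSpace ℝ (G i)]
    [∀ i, CompleteSpace (G i)]
    {X : Fin m → Type*} [∀ i, NormedAddCommGroup (X i)] [∀ i, InnerProductSpace ℝ (X i)]
    [∀ i, CompleteSpace (X i)]
    {Y : Fin m → Type*} [∀ i, NormedAddCommGroup (Y i)] [∀ i, InnerProductSpace ℝ (Y i)]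
    [∀ i, CompleteSpace (Y i)]
    (z : H) (f : H → EReal) (h : H → ℝ)
    (g : ∀ i, X i → EReal) (l : ∀ i, Y i → EReal) (r : ∀ i, G i)
    (L : ∀ i, H →L[ℝ] G i) (K : ∀ i, G i →L[ℝ] X i) (M : ∀ i, G i →L[ℝ] Y i)
    (x : H) : EReal :=
  f x + (∑ i, einfConv (fun w => g i (K i w)) (fun w => l i (M i w)) (L i x - r i)) +
    ((h x - ⟪x, z⟫ : ℝ) : EReal)

/-- the objective value of the dual problem (D) -/
def Dval {m : ℕ}
    {H : Type*} [NormedAddCommGroup H] [InnerProductSpace ℝ H] [CompleteSpace H]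
    {G : Fin m → Type*} [∀ i, NormedAddCommGroup (G i)] [∀ i, InnerProductSpace ℝ (G i)]
    [∀ i, CompleteSpace (G i)]
    {X : Fin m → Type*} [∀ i, NormedAddCommGroup (X i)] [∀ i, InnerProductSpace ℝ (X i)]
    [∀ i, CompleteSpace (X i)]
    {Y : Fin m → Type*} [∀ i, NormedAddCommGroup (Y i)] [∀ i, InnerProductSpace ℝ (Y i)]
    [∀ i, CompleteSpace (Y i)]
    (z : H) (f : H → EReal) (h : H → ℝ)
    (g : ∀ i, X i → EReal) (l : ∀ i, Y i → EReal) (r : ∀ i, G i)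
    (L : ∀ i, H →L[ℝ] G i) (K : ∀ i, G i →L[ℝ] X i) (M : ∀ i, G i →L[ℝ] Y i)
    (p : ∀ i, X i) (q : ∀ i, Y i) : EReal :=
  - einfConv (econj f) (econj (fun x => (h x : EReal)))
      (z - ∑ i, ContinuousLinearMap.adjoint (L i) (ContinuousLinearMap.adjoint (K i) (p i)))
    - ∑ i, (econj (g i) (p i) + econj (l i) (q i) + ((⟪p i, K i (r i)⟫ : ℝ) : EReal))

section FenchelMoreau

variable {E : Type*} [NormedAddCommGroup E] [InnerProductSpace ℝ E]

theorem ProperConvLsc.convex_real_epigraph {f : E → EReal} (hf : ProperConvLsc f) :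
    Convex ℝ {w : E × ℝ | f w.1 ≤ (w.2 : EReal)} := by
  rintro ⟨x, s⟩ hx ⟨y, t⟩ hy a b ha hb hab
  simp only [Set.mem_ofPred_eq] at hx hy
  change f (a • x + b • y) ≤ ((a * s + b * t : ℝ) : EReal)
  refine (hf.2.2.1 x y a b ha hb hab).trans ?_
  push_cast
  exact add_le_add (mul_le_mul_of_nonneg_left hx (by exact_mod_cast ha))
    (mul_le_mul_of_nonneg_left hy (by exact_mod_cast hb))

theorem ProperConvLsc.isClosed_real_epigraph {f : E → EReal} (hf : ProperConvLsc f) :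
    IsClosed {w : E × ℝ | f w.1 ≤ (w.2 : EReal)} :=
  hf.2.2.2.isClosed_epigraph.preimage
    (continuous_fst.prodMk (continuous_coe_real_ereal.comp continuous_snd))

theorem ProperConvLsc.exists_coe_eq {f : E → EReal} (hf : ProperConvLsc f) :
    ∃ (x : E) (t : ℝ), f x = t := by
  obtain ⟨x, hx⟩ := hf.1
  exact ⟨x, (f x).toReal, (EReal.coe_toReal hx (hf.2.1 x)).symm⟩

theorem ProperConvLsc.exists_separation [CompleteSpace E] {f : E → EReal} (hf : ProperConvLsc f)
    {u : E} {c : ℝ} (hc : (c : EReal) < f u) :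
    ∃ (q : E) (s α : ℝ), 0 ≤ s ∧ ⟪q, u⟫ + s * c < α ∧
      ∀ (y : E) (t : ℝ), f y ≤ t → α < ⟪q, y⟫ + s * t := by
  obtain ⟨φ, α, h1, h2⟩ := geometric_hahn_banach_point_closed (x := (u, c))
    hf.convex_real_epigraph hf.isClosed_real_epigraph (by simpa using hc)
  set q : E := (InnerProductSpace.toDual ℝ E).symm (φ.comp (ContinuousLinearMap.inl ℝ E ℝ))
  have hφ : ∀ (y : E) (t : ℝ), φ (y, t) = ⟪q, y⟫ + φ (0, 1) * t := by
    intro y t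
    have h3 : (⟪q, y⟫ : ℝ) = φ (y, 0) := by
      simp [q, InnerProductSpace.toDual_symm_apply]
    have h4 : ((y, t) : E × ℝ) = (y, 0) + t • ((0, 1) : E × ℝ) := by simp
    rw [h3, h4, map_add, map_smul, smul_eq_mul, mul_comm]
  have h5 : ∀ (y : E) (t : ℝ), f y ≤ t → α < ⟪q, y⟫ + φ (0, 1) * t := fun y t ht =>
    hφ y t ▸ h2 (y, t) ht
  refine ⟨q, φ (0, 1), α, ?_, hφ u c ▸ h1, h5⟩
  by_contra! hs
  obtain ⟨x, t, hxt⟩ := hf.exists_coe_eq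
  have h6 := h5 x t hxt.le
  have h7 := h5 x (t + (⟪q, x⟫ + φ (0, 1) * t - α) / (-φ (0, 1))) (by
    rw [hxt, EReal.coe_le_coe_iff]
    have : 0 ≤ (⟪q, x⟫ + φ (0, 1) * t - α) / (-φ (0, 1)) :=
      div_nonneg (by linarith) (by linarith)
    linarith)
  have h8 : φ (0, 1) * (t + (⟪q, x⟫ + φ (0, 1) * t - α) / (-φ (0, 1))) =
      φ (0, 1) * t - (⟪q, x⟫ + φ (0, 1) * t - α) := by
    field_simp [hs.ne]
    ring
  linarith

/-- A separating hyperplane of positive slope gives an affine minorant. -/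
theorem exists_affine_minorant_of_separation {f : E → EReal} {u : E} {c : ℝ}
    {q : E} {s α : ℝ} (hs : 0 < s) (h1 : ⟪q, u⟫ + s * c < α)
    (h2 : ∀ (y : E) (t : ℝ), f y ≤ t → α < ⟪q, y⟫ + s * t) :
    ∃ (p : E) (β : ℝ), β < ⟪p, u⟫ - c ∧ ∀ (y : E) (t : ℝ), f y ≤ t → ⟪p, y⟫ - t ≤ β := by
  refine ⟨(-s⁻¹) • q, -s⁻¹ * α, ?_, fun y t ht => ?_⟩
  · rw [real_inner_smul_left]
    have := mul_lt_mul_of_pos_left h1 (inv_pos.2 hs)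
    rw [mul_add, inv_mul_cancel_left₀ hs.ne'] at this
    linarith
  · rw [real_inner_smul_left]
    have := mul_lt_mul_of_pos_left (h2 y t ht) (inv_pos.2 hs)
    rw [mul_add, inv_mul_cancel_left₀ hs.ne'] at this
    linarith

theorem ProperConvLsc.exists_affine_minorant [CompleteSpace E] {f : E → EReal}
    (hf : ProperConvLsc f) {u : E} {c : ℝ} (hc : (c : EReal) < f u) :
    ∃ (p : E) (β : ℝ), β < ⟪p, u⟫ - c ∧ ∀ (y : E) (t : ℝ), f y ≤ t → ⟪p, y⟫ - t ≤ β := by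
  obtain ⟨q, s, α, hs, h1, h2⟩ := hf.exists_separation hc
  rcases hs.lt_or_eq with hs | rfl
  · exact exists_affine_minorant_of_separation hs h1 h2
  obtain ⟨x, t, hxt⟩ := hf.exists_coe_eq
  obtain ⟨q₀, s₀, α₀, -, h3, h4⟩ := hf.exists_separation (u := x) (c := t - 1)
    (by rw [hxt, EReal.coe_lt_coe_iff]; linarith)
  have hs₀ : 0 < s₀ := by nlinarith [h4 x t hxt.le]
  obtain ⟨p₀, β₀, -, h5⟩ := exists_affine_minorant_of_separation hs₀ h3 h4
  simp only [zero_mul, add_zero] at h1 h2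
  -- a vertical hyperplane is tilted by a large multiple
  obtain ⟨k, hk⟩ := exists_nat_gt ((β₀ - ⟪p₀, u⟫ + c) / (α - ⟪q, u⟫))
  rw [div_lt_iff₀ (by linarith)] at hk
  refine ⟨p₀ - (k : ℝ) • q, β₀ - k * α, ?_, fun y t ht => ?_⟩
  · rw [inner_sub_left, real_inner_smul_left]
    linarith
  · rw [inner_sub_left, real_inner_smul_left]
    have := mul_le_mul_of_nonneg_left (h2 y t ht).le (Nat.cast_nonneg (α := ℝ) k)
    linarith [h5 y t ht]

theorem econj_le_coe {f : E → EReal} {p : E} {β : ℝ} (hf : ∀ x, f x ≠ ⊥)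
    (h : ∀ (y : E) (t : ℝ), f y ≤ t → ⟪p, y⟫ - t ≤ β) : econj f p ≤ β := by
  refine iSup_le fun y => ?_
  by_cases hy : f y = ⊤
  · simp [hy]
  · have hy' := EReal.coe_toReal hy (hf y)
    rw [← hy', ← EReal.coe_sub, EReal.coe_le_coe_iff]
    exact h y _ hy'.ge

theorem coe_inner_sub_le_econj {f : E → EReal} {x : E} {a : ℝ} (hx : f x ≤ a) (p : E) :
    ((⟪p, x⟫ - a : ℝ) : EReal) ≤ econj f p := by
  rw [EReal.coe_sub]
  exact (EReal.sub_le_sub le_rfl hx).trans (le_iSup (fun y => ((⟪p, y⟫ : ℝ) : EReal) - f y) x)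

theorem coe_inner_sub_le_of_econj_le {f : E → EReal} {p : E} {b : ℝ} (hp : econj f p ≤ b)
    (x : E) : ((⟪p, x⟫ - b : ℝ) : EReal) ≤ f x := by
  refine EReal.le_of_forall_lt_iff_le.1 fun t ht => ?_
  have := (coe_inner_sub_le_econj ht.le p).trans hp
  rw [EReal.coe_le_coe_iff] at this ⊢
  linarith

/-- Equality in the Fenchel-Young inequality for a subgradient. -/
theorem econj_le_of_mem_esubdiff {f : E → EReal} (hf : ∀ x, f x ≠ ⊥) {x p : E} {a : ℝ}
    (hx : f x = a) (hp : p ∈ esubdiff f x) : econj f p ≤ ((⟪p, x⟫ - a : ℝ) : EReal) := by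
  refine econj_le_coe hf fun y t ht => ?_
  have := (hp.2.2 y).trans ht
  rw [hx, ← EReal.coe_add, EReal.coe_le_coe_iff, inner_sub_right] at this
  linarith

/-- Equality in the Fenchel-Young inequality for a subgradient of the conjugate. -/
theorem ProperConvLsc.exists_of_mem_esubdiff_econj [CompleteSpace E] {f : E → EReal}
    (hf : ProperConvLsc f) {u p : E} (hu : u ∈ esubdiff (econj f) p) :
    ∃ a b : ℝ, f u = a ∧ econj f p = b ∧ a + b = ⟪p, u⟫ := by
  obtain ⟨htop, hbot, hsub⟩ := hu
  obtain ⟨b, hb⟩ : ∃ b : ℝ, econj f p = b :=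
    ⟨_, (EReal.coe_toReal htop hbot).symm⟩
  refine ⟨⟪p, u⟫ - b, b, le_antisymm ?_ (coe_inner_sub_le_of_econj_le hb.le u), hb, by ring⟩
  by_contra! hlt
  obtain ⟨q, β, h1, h2⟩ := hf.exists_affine_minorant hlt
  have h3 := (hsub q).trans (econj_le_coe hf.2.1 h2)
  rw [hb, ← EReal.coe_add, EReal.coe_le_coe_iff, inner_sub_right, real_inner_comm q u,
    real_inner_comm p u] at h3
  linarith

theorem convexOn_of_properConvLsc {h : E → ℝ} (hh : ProperConvLsc (fun x => (h x : EReal))) :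
    ConvexOn ℝ Set.univ h :=
  ⟨convex_univ, fun x _ y _ a b ha hb hab => by
    have := hh.2.2.1 x y a b ha hb hab
    beta_reduce at this
    exact_mod_cast this⟩

theorem ConvexOn.add_inner_le_of_hasGradientAt [CompleteSpace E] {h : E → ℝ}
    (hh : ConvexOn ℝ Set.univ h) {x v : E} (hv : HasGradientAt h v x) (y : E) :
    h x + ⟪v, y - x⟫ ≤ h y := by
  have h1 : ConvexOn ℝ Set.univ (h ∘ AffineMap.lineMap (k := ℝ) x y) := by
    simpa using hh.comp_affineMap (AffineMap.lineMap (k := ℝ) x y)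
  have h2 : HasDerivAt (h ∘ AffineMap.lineMap (k := ℝ) x y) ⟪v, y - x⟫ (0 : ℝ) := by
    have h3 := HasFDerivAt.comp_hasDerivAt (x := (0 : ℝ)) (f := AffineMap.lineMap (k := ℝ) x y)
      (l := h) (l' := InnerProductSpace.toDual ℝ E v)
      (by simpa using hv.hasFDerivAt) AffineMap.hasDerivAt_lineMap
    simpa using h3
  have h4 := h1.le_slope_of_hasDerivAt (x := 0) (y := 1) trivial trivial one_pos h2
  simp only [slope, sub_zero, inv_one, Function.comp_apply, AffineMap.lineMap_apply_zero,
    AffineMap.lineMap_apply_one, vsub_eq_sub, one_smul] at h4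
  linarith

end FenchelMoreau

theorem EReal.coe_fintype_sum {ι : Type*} [Fintype ι] (f : ι → ℝ) :
    ((∑ i, f i : ℝ) : EReal) = ∑ i, (f i : EReal) :=
  map_sum (⟨⟨Real.toEReal, EReal.coe_zero⟩, EReal.coe_add⟩ : ℝ →+ EReal) f Finset.univ

theorem stmt12 {m : ℕ}
    {H : Type*} [NormedAddCommGroup H] [InnerProductSpace ℝ H] [CompleteSpace H]
    {G : Fin m → Type*} [∀ i, NormedAddCommGroup (G i)] [∀ i, InnerProductSpace ℝ (G i)]
    [∀ i, CompleteSpace (G i)]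
    {X : Fin m → Type*} [∀ i, NormedAddCommGroup (X i)] [∀ i, InnerProductSpace ℝ (X i)]
    [∀ i, CompleteSpace (X i)]
    {Y : Fin m → Type*} [∀ i, NormedAddCommGroup (Y i)] [∀ i, InnerProductSpace ℝ (Y i)]
    [∀ i, CompleteSpace (Y i)]
    (z : H)
    (f : H → EReal) (hf : ProperConvLsc f)
    (μ : ℝ) (hμ : 0 < μ)
    (h : H → ℝ) (hh : ProperConvLsc (fun x => (h x : EReal)))
    (h' : H → H) (hgrad : ∀ x, HasGradientAt h (h' x) x)
    (hlip : ∀ x y : H, ‖h' x - h' y‖ ≤ μ * ‖x - y‖)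
    (r : ∀ i, G i)
    (g : ∀ i, X i → EReal) (hg : ∀ i, ProperConvLsc (g i))
    (l : ∀ i, Y i → EReal) (hl : ∀ i, ProperConvLsc (l i))
    (L : ∀ i, H →L[ℝ] G i) (hL : ∀ i, L i ≠ 0)
    (K : ∀ i, G i →L[ℝ] X i) (hK : ∀ i, K i ≠ 0)
    (M : ∀ i, G i →L[ℝ] Y i) (hM : ∀ i, M i ≠ 0)
    (xb : H) (pb : ∀ i, X i) (qb : ∀ i, Y i) (yb : ∀ i, G i)
    -- the optimality system
    (hsys1 : z - ∑ i, ContinuousLinearMap.adjoint (L i)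
        (ContinuousLinearMap.adjoint (K i) (pb i)) - h' xb ∈ esubdiff f xb)
    (hsys2 : ∀ i, K i (L i xb - yb i - r i) ∈ esubdiff (econj (g i)) (pb i))
    (hsys3 : ∀ i, M i (yb i) ∈ esubdiff (econj (l i)) (qb i))
    (hsys4 : ∀ i, ContinuousLinearMap.adjoint (K i) (pb i) =
        ContinuousLinearMap.adjoint (M i) (qb i)) :
    (∀ x : H, Pval z f h g l r L K M xb ≤ Pval z f h g l r L K M x) ∧
    (∀ (p : ∀ i, X i) (q : ∀ i, Y i),
      (∀ i, ContinuousLinearMap.adjoint (K i) (p i) =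
        ContinuousLinearMap.adjoint (M i) (q i)) →
      Dval z f h g l r L K M p q ≤ Dval z f h g l r L K M pb qb) ∧
    Pval z f h g l r L K M xb = Dval z f h g l r L K M pb qb := by
  choose a b ha hb hab using fun i => (hg i).exists_of_mem_esubdiff_econj (hsys2 i)
  choose c d hc hd hcd using fun i => (hl i).exists_of_mem_esubdiff_econj (hsys3 i)
  obtain ⟨F, hF⟩ : ∃ F : ℝ, f xb = F := ⟨_, (EReal.coe_toReal hsys1.1 hsys1.2.1).symm⟩
  have hgi := (convexOn_of_properConvLsc hh).add_inner_le_of_hasGradientAt (hgrad xb)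
  have hinner : ∀ (p : ∀ i, X i) (x : H),
      ⟪∑ i, ContinuousLinearMap.adjoint (L i) (ContinuousLinearMap.adjoint (K i) (p i)), x⟫ =
        ∑ i, ⟪p i, K i (L i x)⟫ := fun p x => by
    simp only [sum_inner, ContinuousLinearMap.adjoint_inner_left]
  have hswap : ∀ (p : ∀ i, X i) (q : ∀ i, Y i), (∀ i, ContinuousLinearMap.adjoint (K i) (p i) =
      ContinuousLinearMap.adjoint (M i) (q i)) →
      ∀ i (w : G i), ⟪p i, K i w⟫ = ⟪q i, M i w⟫ := fun p q hpq i w => by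
    rw [← ContinuousLinearMap.adjoint_inner_left, hpq i, ContinuousLinearMap.adjoint_inner_left]
  have hab' : ∀ i, a i + b i = ⟪pb i, K i (L i xb)⟫ - ⟪pb i, K i (yb i)⟫ - ⟪pb i, K i (r i)⟫ :=
    fun i => by rw [hab, map_sub, map_sub, inner_sub_right, inner_sub_right]
  have hcd' : ∀ i, c i + d i = ⟪pb i, K i (yb i)⟫ := fun i => by
    rw [hcd, hswap pb qb hsys4]
  set V : ℝ := F + ∑ i, (a i + c i) + (h xb - ⟪xb, z⟫) with hV
  have primal_le : Pval z f h g l r L K M xb ≤ V := by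
    rw [hV, EReal.coe_add, EReal.coe_add, EReal.coe_fintype_sum]
    refine add_le_add (add_le_add hF.le (Finset.sum_le_sum fun i _ => ?_)) le_rfl
    refine (iInf_le _ (L i xb - yb i - r i)).trans ?_
    have : L i xb - r i - (L i xb - yb i - r i) = yb i := by abel
    beta_reduce
    rw [this, ha, hc, EReal.coe_add]
  have le_primal : ∀ x, (V : EReal) ≤ Pval z f h g l r L K M x := by
    intro x
    have h1 := hsys1.2.2 x
    have h2 : ∀ i, ((⟪pb i, K i (L i x)⟫ - ⟪pb i, K i (r i)⟫ - b i - d i : ℝ) : EReal) ≤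
        einfConv (fun w => g i (K i w)) (fun w => l i (M i w)) (L i x - r i) := by
      intro i
      refine le_iInf fun y => ?_
      refine le_trans (le_of_eq ?_) (add_le_add
        (coe_inner_sub_le_of_econj_le (hb i).le (K i y))
        (coe_inner_sub_le_of_econj_le (hd i).le (M i (L i x - r i - y))))
      rw [← EReal.coe_add, ← hswap pb qb hsys4, map_sub, map_sub, inner_sub_right,
        inner_sub_right]
      congr 1
      ring
    have h3 := Finset.sum_le_sum fun i (_ : i ∈ Finset.univ) => h2 i
    rw [← EReal.coe_fintype_sum] at h3
    rw [hF, ← EReal.coe_add] at h1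
    refine le_trans ?_ (add_le_add (add_le_add h1 h3) le_rfl)
    rw [← EReal.coe_add, ← EReal.coe_add, EReal.coe_le_coe_iff]
    have h4 := hgi x
    have h5 : ∑ i, (a i + c i) = ∑ i, (⟪pb i, K i (L i xb)⟫ - ⟪pb i, K i (r i)⟫ - b i - d i) :=
      Finset.sum_congr rfl fun i _ => by linarith [hab' i, hcd' i]
    rw [hV, h5]
    simp only [Finset.sum_sub_distrib, inner_sub_left, inner_sub_right, hinner] at h4 ⊢
    rw [real_inner_comm z x, real_inner_comm z xb]
    linarith
  have le_dual : (V : EReal) ≤ Dval z f h g l r L K M pb qb := by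
    set S := ∑ i, ContinuousLinearMap.adjoint (L i) (ContinuousLinearMap.adjoint (K i) (pb i))
      with hS
    have h1 : einfConv (econj f) (econj (fun x => (h x : EReal))) (z - S) ≤
        ((⟪z - S - h' xb, xb⟫ - F + (⟪h' xb, xb⟫ - h xb) : ℝ) : EReal) := by
      refine (iInf_le _ (z - S - h' xb)).trans ?_
      rw [sub_sub_cancel, EReal.coe_add]
      refine add_le_add (econj_le_of_mem_esubdiff hf.2.1 hF hsys1)
        (econj_le_of_mem_esubdiff (fun x => EReal.coe_ne_bot _) rfl
          ⟨EReal.coe_ne_top _, EReal.coe_ne_bot _, fun y => ?_⟩)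
      beta_reduce
      exact_mod_cast hgi y
    have h2 : ∑ i, (econj (g i) (pb i) + econj (l i) (qb i) +
        ((⟪pb i, K i (r i)⟫ : ℝ) : EReal)) =
        ((∑ i, (b i + d i + ⟪pb i, K i (r i)⟫) : ℝ) : EReal) := by
      rw [EReal.coe_fintype_sum]
      exact Finset.sum_congr rfl fun i _ => by rw [hb, hd, EReal.coe_add, EReal.coe_add]
    refine le_trans ?_ (EReal.sub_le_sub (EReal.neg_le_neg_iff.2 h1) h2.le)
    rw [← EReal.coe_neg, ← EReal.coe_sub, EReal.coe_le_coe_iff]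
    have h5 : ∑ i, (a i + c i) =
        ∑ i, (⟪pb i, K i (L i xb)⟫ - (b i + d i + ⟪pb i, K i (r i)⟫)) :=
      Finset.sum_congr rfl fun i _ => by linarith [hab' i, hcd' i]
    rw [hV, h5, Finset.sum_sub_distrib, ← hinner, ← hS, inner_sub_left, inner_sub_left,
      real_inner_comm z xb]
    linarith
  have dual_le : ∀ (p : ∀ i, X i) (q : ∀ i, Y i),
      (∀ i, ContinuousLinearMap.adjoint (K i) (p i) =
        ContinuousLinearMap.adjoint (M i) (q i)) →
      Dval z f h g l r L K M p q ≤ V := by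
    intro p q hpq
    set S := ∑ i, ContinuousLinearMap.adjoint (L i) (ContinuousLinearMap.adjoint (K i) (p i))
      with hS
    have h1 : ((⟪z - S, xb⟫ - F - h xb : ℝ) : EReal) ≤
        einfConv (econj f) (econj (fun x => (h x : EReal))) (z - S) := by
      refine le_iInf fun y => ?_
      refine le_trans (le_of_eq ?_) (add_le_add (coe_inner_sub_le_econj hF.le y)
        (coe_inner_sub_le_econj (f := fun x => (h x : EReal)) (x := xb) le_rfl (z - S - y)))
      rw [← EReal.coe_add, inner_sub_left (z - S) y]
      congr 1
      ring
    have h2 : ((∑ i, (⟪p i, K i (L i xb)⟫ - a i - c i) : ℝ) : EReal) ≤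
        ∑ i, (econj (g i) (p i) + econj (l i) (q i) + ((⟪p i, K i (r i)⟫ : ℝ) : EReal)) := by
      rw [EReal.coe_fintype_sum]
      refine Finset.sum_le_sum fun i _ => ?_
      refine le_trans (le_of_eq ?_) (add_le_add (add_le_add
        (coe_inner_sub_le_econj (ha i).le (p i)) (coe_inner_sub_le_econj (hc i).le (q i))) le_rfl)
      rw [← EReal.coe_add, ← EReal.coe_add, ← hswap p q hpq, map_sub, map_sub, inner_sub_right,
        inner_sub_right]
      congr 1
      ring
    refine (EReal.sub_le_sub (EReal.neg_le_neg_iff.2 h1) h2).trans ?_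
    rw [← EReal.coe_neg, ← EReal.coe_sub, EReal.coe_le_coe_iff]
    have h5 : ∑ i, (⟪p i, K i (L i xb)⟫ - a i - c i) =
        ∑ i, ⟪p i, K i (L i xb)⟫ - ∑ i, (a i + c i) := by
      rw [← Finset.sum_sub_distrib]
      exact Finset.sum_congr rfl fun i _ => by ring
    rw [hV, h5, ← hinner, ← hS, inner_sub_left, real_inner_comm z xb]
    linarith
  exact ⟨fun x => primal_le.trans (le_primal x), fun p q hpq => (dual_le p q hpq).trans le_dual,
    le_antisymm (primal_le.trans le_dual) ((dual_le pb qb hsys4).trans (le_primal xb))⟩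
end
end
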